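/- Let X₁ = X₂ = Y₁ = Y₂ = ℂ² and let ε ∈ [0,1]. For any PPT measurement {P₁, P₂, P₃, P₄} on (X₁⊗X₂) : (Y₁⊗Y₂), the success probability of discriminating the four states φ_k ⊗ τ_ε (k = 1, 2, 3, 4) with uniform prior 1/4 satisfies (1/4) Σ_{k=1}^{4} ⟨φ_k ⊗ τ_ε, W P_k W*⟩ ≤ (1 + √(1 − ε²))/2. -/

import Mathlib

open Matrix Complex
open scoped Matrix Kronecker ComplexOrder

noncomputable section

/-- The tensor (Kronecker) product of two vectors. -/
def tens {α β : Type*} (u : α → ℂ) (v : β → ℂ) : α × β → ℂ := fun p => u p.1 * v p.2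

/-- The rank-one operator `u u*`. -/
def proj {α : Type*} (u : α → ℂ) : Matrix α α ℂ := Matrix.vecMulVec u (star u)

/-- A separable (positive semidefinite) operator with respect to the bipartition `α : β`. -/
def SepMat {α β : Type*} [Fintype α] [Fintype β] (P : Matrix (α × β) (α × β) ℂ) : Prop :=
  ∃ (M : ℕ) (Q : Fin M → Matrix α α ℂ) (R : Fin M → Matrix β β ℂ),
    (∀ j, (Q j).PosSemidef) ∧ (∀ j, (R j).PosSemidef) ∧ P = ∑ j, Q j ⊗ₖ R j

/-- The operator `(1 ⊗ y)* H (1 ⊗ y)` on the first factor. -/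
def blockCompress {α β : Type*} [Fintype β] (H : Matrix (α × β) (α × β) ℂ) (y : β → ℂ) :
    Matrix α α ℂ :=
  Matrix.of fun i j => ∑ a, ∑ b, star (y a) * H (i, a) (j, b) * y b

/-- Block positivity with respect to the bipartition `α : β`. -/
def BlockPositive {α β : Type*} [Fintype α] [Fintype β] (H : Matrix (α × β) (α × β) ℂ) : Prop :=
  ∀ y : β → ℂ, (blockCompress H y).PosSemidef

/-- Partial transposition on the first tensor factor. -/
def ptFst {α β : Type*} (M : Matrix (α × β) (α × β) ℂ) : Matrix (α × β) (α × β) ℂ :=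
  Matrix.of fun r c => M (c.1, r.2) (r.1, c.2)

/-- The four Bell states on two qubits. -/
def bellVec : Fin 4 → (Fin 2 × Fin 2) → ℂ :=
  ![fun p => if p.1 = p.2 then ((Real.sqrt 2 : ℂ))⁻¹ else 0,
    fun p => if p = (0, 0) then ((Real.sqrt 2 : ℂ))⁻¹
             else if p = (1, 1) then -((Real.sqrt 2 : ℂ))⁻¹ else 0,
    fun p => if p.1 ≠ p.2 then ((Real.sqrt 2 : ℂ))⁻¹ else 0,
    fun p => if p = (0, 1) then ((Real.sqrt 2 : ℂ))⁻¹
             else if p = (1, 0) then -((Real.sqrt 2 : ℂ))⁻¹ else 0]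

/-- The ancillary resource state `|τ_ε⟩ = √((1+ε)/2)|00⟩ + √((1−ε)/2)|11⟩`. -/
def tauVec (ε : ℝ) : (Fin 2 × Fin 2) → ℂ :=
  fun p => if p = (0, 0) then (Real.sqrt ((1 + ε) / 2) : ℂ)
           else if p = (1, 1) then (Real.sqrt ((1 - ε) / 2) : ℂ) else 0

/-- Conjugation by the swap unitary `W` exchanging the two middle tensor factors:
if `M` is indexed with grouping `((a₁, a₂), (b₁, b₂))`, the result is indexed with
grouping `((a₁, b₁), (a₂, b₂))`. -/
def regroup {α₁ α₂ β₁ β₂ : Type*}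
    (M : Matrix ((α₁ × α₂) × (β₁ × β₂)) ((α₁ × α₂) × (β₁ × β₂)) ℂ) :
    Matrix ((α₁ × β₁) × (α₂ × β₂)) ((α₁ × β₁) × (α₂ × β₂)) ℂ :=
  Matrix.of fun r c =>
    M ((r.1.1, r.2.1), (r.1.2, r.2.2)) ((c.1.1, c.2.1), (c.1.2, c.2.2))

/-- A PPT operator with respect to the bipartition `α : β`. -/
def PPTMat {α β : Type*} [Fintype α] [Fintype β] (P : Matrix (α × β) (α × β) ℂ) : Prop :=
  P.PosSemidef ∧ (ptFst P).PosSemidef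

/-- The real pairing of `A ⊗ B` with a regrouped operator. -/
def pairF (A B : Matrix (Fin 2 × Fin 2) (Fin 2 × Fin 2) ℂ)
    (M : Matrix ((Fin 2 × Fin 2) × (Fin 2 × Fin 2)) ((Fin 2 × Fin 2) × (Fin 2 × Fin 2)) ℂ) : ℝ :=
  (((A ⊗ₖ B) * regroup M).trace).re

theorem pairF_add_left (A A' B M) : pairF (A + A') B M = pairF A B M + pairF A' B M := by
  simp [pairF, Matrix.add_kronecker, Matrix.add_mul]

theorem pairF_sub_left (A A' B M) : pairF (A - A') B M = pairF A B M - pairF A' B M := by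
  have h := pairF_add_left (A - A') A' B M
  rw [sub_add_cancel] at h
  linarith

theorem pairF_smul_left (r : ℝ) (A B M) : pairF ((r : ℂ) • A) B M = r * pairF A B M := by
  simp [pairF, Matrix.smul_kronecker]

theorem pairF_add_right (A B B' M) : pairF A (B + B') M = pairF A B M + pairF A B' M := by
  simp [pairF, Matrix.kronecker_add, Matrix.add_mul]

theorem pairF_sub_right (A B B' M) : pairF A (B - B') M = pairF A B M - pairF A B' M := by
  have h := pairF_add_right A (B - B') B' M
  rw [sub_add_cancel] at h
  linarith

theorem pairF_smul_right (r : ℝ) (A B M) : pairF A ((r : ℂ) • B) M = r * pairF A B M := by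
  simp [pairF, Matrix.kronecker_smul]

theorem pairF_add_op (A B M N) : pairF A B (M + N) = pairF A B M + pairF A B N := by
  have : regroup (M + N) = regroup M + regroup N := by ext; simp [regroup]
  simp [pairF, this, Matrix.mul_add]

theorem pairF_one (A B) : pairF A B 1 = (A.trace * B.trace).re := by
  have : regroup (1 : Matrix ((Fin 2 × Fin 2) × (Fin 2 × Fin 2))
      ((Fin 2 × Fin 2) × (Fin 2 × Fin 2)) ℂ) = 1 := by
    ext ⟨⟨a, b⟩, ⟨c, d⟩⟩ ⟨⟨a', b'⟩, ⟨c', d'⟩⟩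
    simp only [regroup, Matrix.of_apply, Matrix.one_apply, Prod.mk.injEq]
    congr 1
    simp only [eq_iff_iff]
    tauto
  simp only [pairF, this, Matrix.mul_one, Matrix.trace_kronecker]

theorem pairF_proj_nonneg (u v M) (hM : M.PosSemidef) : 0 ≤ pairF (proj u) (proj v) M := by
  have h1 : (proj u ⊗ₖ proj v) = Matrix.vecMulVec (tens u v) (star (tens u v)) := by
    ext ⟨a, b⟩ ⟨c, d⟩
    simp [proj, tens, Matrix.vecMulVec_apply]
    ring
  have h2 : (regroup M).PosSemidef :=
    hM.submatrix (fun r : (Fin 2 × Fin 2) × (Fin 2 × Fin 2) =>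
      ((r.1.1, r.2.1), (r.1.2, r.2.2)))
  have h3 := h2.dotProduct_mulVec_nonneg (tens u v)
  rw [pairF, h1, Matrix.vecMulVec_mul, Matrix.trace_vecMulVec, dotProduct_comm,
    ← Matrix.dotProduct_mulVec]
  exact (Complex.le_def.1 h3).1

/-- Swap the first-party indices of a pair of indices. -/
def swapIdx : (((Fin 2 × Fin 2) × (Fin 2 × Fin 2)) × ((Fin 2 × Fin 2) × (Fin 2 × Fin 2))) ≃
    (((Fin 2 × Fin 2) × (Fin 2 × Fin 2)) × ((Fin 2 × Fin 2) × (Fin 2 × Fin 2))) where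
  toFun p := (((p.2.1.1, p.1.1.2), (p.2.2.1, p.1.2.2)), ((p.1.1.1, p.2.1.2), (p.1.2.1, p.2.2.2)))
  invFun p := (((p.2.1.1, p.1.1.2), (p.2.2.1, p.1.2.2)), ((p.1.1.1, p.2.1.2), (p.1.2.1, p.2.2.2)))
  left_inv _ := rfl
  right_inv _ := rfl

theorem pairF_ptFst (A B M) : pairF (ptFst A) (ptFst B) (ptFst M) = pairF A B M := by
  unfold pairF
  congr 1
  simp only [Matrix.trace, Matrix.diag, Matrix.mul_apply]
  rw [← Fintype.sum_prod_type', ← Fintype.sum_prod_type']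
  exact Fintype.sum_equiv swapIdx _ _ (fun p => rfl)

theorem ptFst_ptFst {α β : Type*} (M : Matrix (α × β) (α × β) ℂ) : ptFst (ptFst M) = M := rfl

theorem pairF_ptFst' (A B M) : pairF A B (ptFst M) = pairF (ptFst A) (ptFst B) M :=
  pairF_ptFst (ptFst A) (ptFst B) M

theorem ptFst_one' : ptFst (1 : Matrix (Fin 2 × Fin 2) (Fin 2 × Fin 2) ℂ) = 1 := by
  ext ⟨a, b⟩ ⟨c, d⟩
  fin_cases a <;> fin_cases b <;> fin_cases c <;> fin_cases d <;> simp [ptFst]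

theorem inv_sqrt_two_sq : ((Real.sqrt 2 : ℂ))⁻¹ * ((Real.sqrt 2 : ℂ))⁻¹ = 1 / 2 := by
  rw [← mul_inv, ← Complex.ofReal_mul, Real.mul_self_sqrt (by norm_num)]
  norm_num

theorem bell_pt (k : Fin 4) :
    ptFst (proj (bellVec k)) = ((1 / 2 : ℝ) : ℂ) • 1 - proj (bellVec k.rev) := by
  have h := inv_sqrt_two_sq
  ext ⟨a, b⟩ ⟨c, d⟩
  fin_cases k <;> fin_cases a <;> fin_cases b <;> fin_cases c <;> fin_cases d <;>
    simp [ptFst, proj, bellVec, Matrix.vecMulVec_apply, Fin.rev] <;>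
    linear_combination h

theorem bell_sum : ∑ k, proj (bellVec k) = 1 := by
  have h := inv_sqrt_two_sq
  ext ⟨a, b⟩ ⟨c, d⟩
  fin_cases a <;> fin_cases b <;> fin_cases c <;> fin_cases d <;>
    simp [proj, bellVec, Matrix.vecMulVec_apply, Fin.sum_univ_four] <;>
    linear_combination 2 * h

/-- Standard basis vector of two qubits. -/
def baseVec (q : Fin 2 × Fin 2) : Fin 2 × Fin 2 → ℂ := fun p => if p = q then 1 else 0

theorem tau_pt (ε : ℝ) (h0 : 0 ≤ ε) (h1 : ε ≤ 1) :
    ptFst (proj (tauVec ε)) = (((1 + ε) / 2 : ℝ) : ℂ) • proj (baseVec (0, 0))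
      + (((1 - ε) / 2 : ℝ) : ℂ) • proj (baseVec (1, 1))
      + ((Real.sqrt (1 - ε ^ 2) / 2 : ℝ) : ℂ) • (proj (bellVec 2) - proj (bellVec 3)) := by
  have h := inv_sqrt_two_sq
  have ha : (Real.sqrt ((1 + ε) / 2) : ℂ) * (Real.sqrt ((1 + ε) / 2) : ℂ) = (1 + ε) / 2 := by
    rw [← Complex.ofReal_mul, Real.mul_self_sqrt (by linarith)]
    push_cast
    ring
  have hb : (Real.sqrt ((1 - ε) / 2) : ℂ) * (Real.sqrt ((1 - ε) / 2) : ℂ) = (1 - ε) / 2 := by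
    rw [← Complex.ofReal_mul, Real.mul_self_sqrt (by linarith)]
    push_cast
    ring
  have hc : (Real.sqrt ((1 + ε) / 2) : ℂ) * (Real.sqrt ((1 - ε) / 2) : ℂ)
      = (Real.sqrt (1 - ε ^ 2) : ℂ) / 2 := by
    rw [← Complex.ofReal_mul, ← Real.sqrt_mul (by linarith)]
    have : (1 + ε) / 2 * ((1 - ε) / 2) = (1 - ε ^ 2) / 2 ^ 2 := by ring
    rw [this, Real.sqrt_div' _ (by norm_num), Real.sqrt_sq (by norm_num)]
    push_cast
    ring
  generalize Real.sqrt (1 - ε ^ 2) = s at *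
  generalize hx : Real.sqrt ((1 + ε) / 2) = x at *
  generalize hy : Real.sqrt ((1 - ε) / 2) = y at *
  ext ⟨a, b⟩ ⟨c, d⟩
  fin_cases a <;> fin_cases b <;> fin_cases c <;> fin_cases d <;>
    simp [ptFst, proj, tauVec, baseVec, bellVec, Matrix.vecMulVec_apply, hx, hy] <;>
    first
    | linear_combination ha
    | linear_combination hb
    | linear_combination hc - (s : ℂ) * h

theorem trace_tau (ε : ℝ) (h0 : 0 ≤ ε) (h1 : ε ≤ 1) : (proj (tauVec ε)).trace = 1 := by
  have ha : (Real.sqrt ((1 + ε) / 2) : ℂ) * (Real.sqrt ((1 + ε) / 2) : ℂ) = (1 + ε) / 2 := by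
    rw [← Complex.ofReal_mul, Real.mul_self_sqrt (by linarith)]
    push_cast
    ring
  have hb : (Real.sqrt ((1 - ε) / 2) : ℂ) * (Real.sqrt ((1 - ε) / 2) : ℂ) = (1 - ε) / 2 := by
    rw [← Complex.ofReal_mul, Real.mul_self_sqrt (by linarith)]
    push_cast
    ring
  generalize hx : Real.sqrt ((1 + ε) / 2) = x at *
  generalize hy : Real.sqrt ((1 - ε) / 2) = y at *
  simp [Matrix.trace, Fintype.sum_prod_type, Fin.sum_univ_two, proj, tauVec,
    Matrix.vecMulVec_apply, hx, hy]
  linear_combination ha + hb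

theorem trace_pt_bell : (ptFst (proj (bellVec 3))).trace = 1 := by
  have h := inv_sqrt_two_sq
  simp [Matrix.trace, Fintype.sum_prod_type, Fin.sum_univ_two, proj, bellVec, ptFst,
    Matrix.vecMulVec_apply]
  linear_combination 2 * h

/-- The key operator inequality (dual feasibility) for a single outcome. -/
theorem single_bound (ε : ℝ) (h0 : 0 ≤ ε) (h1 : ε ≤ 1) (k : Fin 4) (M) (hM : PPTMat M) :
    pairF (proj (bellVec k)) (proj (tauVec ε)) M ≤
      1 / 2 * pairF 1 (proj (tauVec ε)) M
        + Real.sqrt (1 - ε ^ 2) / 2 * pairF 1 (ptFst (proj (bellVec 3))) M := by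
  have hQ : (ptFst M).PosSemidef := hM.2
  have hs := Real.sqrt_nonneg (1 - ε ^ 2)
  have e1 : pairF (proj (bellVec k)) (proj (tauVec ε)) M =
      1 / 2 * pairF 1 (proj (tauVec ε)) M
        - pairF (proj (bellVec k.rev)) (ptFst (proj (tauVec ε))) (ptFst M) := by
    rw [← pairF_ptFst (proj (bellVec k)), bell_pt, pairF_sub_left, pairF_smul_left,
      ← pairF_ptFst 1 (proj (tauVec ε)), ptFst_one']
  have e2 : pairF (1 : Matrix (Fin 2 × Fin 2) (Fin 2 × Fin 2) ℂ) (ptFst (proj (bellVec 3))) M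
      = pairF 1 (proj (bellVec 3)) (ptFst M) := by
    rw [pairF_ptFst', ptFst_one']
  have e3 : pairF (proj (bellVec k.rev)) (proj (bellVec 3)) (ptFst M)
      ≤ pairF 1 (proj (bellVec 3)) (ptFst M) := by
    have n := fun j => pairF_proj_nonneg (bellVec j) (bellVec 3) _ hQ
    rw [← bell_sum, Fin.sum_univ_four]
    simp only [pairF_add_left]
    have n0 := n 0
    have n1 := n 1
    have n2 := n 2
    have n3 := n 3
    fin_cases k <;> simp [Fin.rev] <;> linarith
  rw [e1, e2, tau_pt ε h0 h1]
  simp only [pairF_add_right, pairF_smul_right, pairF_sub_right]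
  have p0 := mul_nonneg (by linarith : 0 ≤ (1 + ε) / 2)
    (pairF_proj_nonneg (bellVec k.rev) (baseVec (0, 0)) _ hQ)
  have p1 := mul_nonneg (by linarith : 0 ≤ (1 - ε) / 2)
    (pairF_proj_nonneg (bellVec k.rev) (baseVec (1, 1)) _ hQ)
  have p2 := mul_nonneg (by linarith : 0 ≤ Real.sqrt (1 - ε ^ 2) / 2)
    (pairF_proj_nonneg (bellVec k.rev) (bellVec 2) _ hQ)
  have p3 := mul_le_mul_of_nonneg_left e3 (by linarith : 0 ≤ Real.sqrt (1 - ε ^ 2) / 2)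
  linarith

/-- The success probability of any PPT measurement at discriminating the four Bell states
assisted by the resource state `τ_ε` (uniform prior) is at most `(1 + √(1 − ε²))/2`. -/
theorem four_bell_ppt_bound (ε : ℝ) (hε : ε ∈ Set.Icc (0 : ℝ) 1)
    (P : Fin 4 → Matrix ((Fin 2 × Fin 2) × (Fin 2 × Fin 2))
      ((Fin 2 × Fin 2) × (Fin 2 × Fin 2)) ℂ)
    (hppt : ∀ k, PPTMat (P k)) (hsum : ∑ k, P k = 1) :
    (1 / 4 : ℝ) * ∑ k : Fin 4,
        (((proj (bellVec k) ⊗ₖ proj (tauVec ε)) * regroup (P k)).trace).re ≤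
      (1 + Real.sqrt (1 - ε ^ 2)) / 2 := by
  obtain ⟨h0, h1⟩ := hε
  have hb := fun k => single_bound ε h0 h1 k (P k) (hppt k)
  have ht : (1 : Matrix (Fin 2 × Fin 2) (Fin 2 × Fin 2) ℂ).trace = 4 := by
    simp [Matrix.trace_one]
  have s1 := pairF_one 1 (proj (tauVec ε))
  have s2 := pairF_one 1 (ptFst (proj (bellVec 3)))
  rw [trace_tau ε h0 h1, ht, ← hsum, Fin.sum_univ_four] at s1
  rw [trace_pt_bell, ht, ← hsum, Fin.sum_univ_four] at s2
  simp only [pairF_add_op] at s1 s2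
  norm_num at s1 s2
  change (1 / 4 : ℝ) * ∑ k : Fin 4, pairF (proj (bellVec k)) (proj (tauVec ε)) (P k) ≤ _
  rw [Fin.sum_univ_four]
  have b0 := hb 0
  have b1 := hb 1
  have b2 := hb 2
  have b3 := hb 3
  have s3 := congrArg (fun t => Real.sqrt (1 - ε ^ 2) / 2 * t) s2
  linarith
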